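/- Let Γ : ℝ → ℝ³ be a 1-periodic Lipschitz curve, injective on [0,1), with positive length, and let v₁, v₂ be affine lines in ℝ³ such that Rot(2π/a₁, v₁) and Rot(2π/a₂, v₂) each map the image Γ(ℝ) onto itself, where a₁, a₂ ≥ 2 are integers. Then the two axes intersect: v₁ ∩ v₂ ≠ ∅. -/

import Mathlib

open MeasureTheory Real Set
open scoped ENNReal NNReal RealInnerProductSpace

/-- Rotation of `ℝ³` by angle `β` about the line through the origin with (unit) direction `u`,
given by Rodrigues' formula
`x ↦ cos β · x + sin β · (u × x) + (1 − cos β)⟨u, x⟩ u`. -/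
noncomputable def rotAxisDir (β : ℝ) (u x : EuclideanSpace ℝ (Fin 3)) :
    EuclideanSpace ℝ (Fin 3) :=
  Real.cos β • x
    + Real.sin β • ((WithLp.equiv 2 (Fin 3 → ℝ)).symm
        (crossProduct (WithLp.equiv 2 (Fin 3 → ℝ) u) (WithLp.equiv 2 (Fin 3 → ℝ) x)))
    + ((1 - Real.cos β) * ⟪u, x⟫) • u

/-- Rotation `Rot(β, ℓ)` of `ℝ³` by angle `β` about the affine line `ℓ = p + ℝu`
(`u` a unit direction): `x ↦ p + R(x − p)` with `R` the rotation by `β` fixing `u`. -/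
noncomputable def rotLine (β : ℝ) (p u : EuclideanSpace ℝ (Fin 3))
    (x : EuclideanSpace ℝ (Fin 3)) : EuclideanSpace ℝ (Fin 3) :=
  p + rotAxisDir β u (x - p)

/-- The action of a `3×3` matrix on `ℝ³` (as a Euclidean space). -/
noncomputable def mulVecE (S : Matrix (Fin 3) (Fin 3) ℝ) (x : EuclideanSpace ℝ (Fin 3)) :
    EuclideanSpace ℝ (Fin 3) :=
  (WithLp.equiv 2 (Fin 3 → ℝ)).symm (S.mulVec (WithLp.equiv 2 (Fin 3 → ℝ) x))

/-- The affine line `p + ℝu` in `ℝ³`. -/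
def affLine (p u : EuclideanSpace ℝ (Fin 3)) : Set (EuclideanSpace ℝ (Fin 3)) :=
  {x | ∃ c : ℝ, x = p + c • u}

/-- A nonempty bounded set in a proper metric space has an enclosing ball of least radius. -/
lemma exists_minimal_closedBall {E : Type*} [MetricSpace E] [ProperSpace E] {S : Set E}
    (hS : S.Nonempty) (hb : Bornology.IsBounded S) :
    ∃ c r, S ⊆ Metric.closedBall c r ∧ ∀ c' r', S ⊆ Metric.closedBall c' r' → r ≤ r' := by
  obtain ⟨s, hs⟩ := hS
  obtain ⟨R, hR⟩ := hb.subset_closedBall s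
  have hclosed : IsClosed {q : E × ℝ | S ⊆ Metric.closedBall q.1 q.2} := by
    have : {q : E × ℝ | S ⊆ Metric.closedBall q.1 q.2}
        = ⋂ x ∈ S, {q : E × ℝ | dist x q.1 ≤ q.2} := by
      ext q
      simp [Set.subset_def]
    rw [this]
    exact isClosed_biInter fun x _ => isClosed_le (by fun_prop) (by fun_prop)
  have hcompact : IsCompact ((Metric.closedBall s R ×ˢ Set.Icc 0 R) ∩
      {q : E × ℝ | S ⊆ Metric.closedBall q.1 q.2}) :=
    ((isCompact_closedBall s R).prod isCompact_Icc).inter_right hclosed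
  have hR0 : 0 ≤ R := by simpa using hR hs
  obtain ⟨⟨c, r⟩, ⟨⟨-, hr⟩, hSr⟩, hmin⟩ := hcompact.exists_isMinOn
    ⟨(s, R), ⟨⟨Metric.mem_closedBall_self hR0, hR0, le_rfl⟩, hR⟩⟩ continuous_snd.continuousOn
  refine ⟨c, r, hSr, fun c' r' h => ?_⟩
  by_cases hr' : r' ≤ R
  · have hd : dist s c' ≤ r' := h hs
    have hc' : dist c' s ≤ R := by
      rw [dist_comm]
      exact hd.trans hr'
    exact hmin (a := (c', r')) ⟨⟨hc', dist_nonneg.trans hd, hr'⟩, h⟩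
  · exact hr.2.trans (not_le.mp hr').le

/-- In an inner product space the centre of an enclosing ball of least radius is unique. -/
lemma center_eq_of_minimal_closedBall {E : Type*} [NormedAddCommGroup E] [InnerProductSpace ℝ E]
    {S : Set E} (hS : S.Nonempty) {c c' : E} {r : ℝ}
    (hc : S ⊆ Metric.closedBall c r) (hc' : S ⊆ Metric.closedBall c' r)
    (hmin : ∀ d t, S ⊆ Metric.closedBall d t → r ≤ t) : c = c' := by
  obtain ⟨s, hs⟩ := hS
  have hr : 0 ≤ r := dist_nonneg.trans (hc hs)
  have key : ∀ x ∈ S, ‖x - midpoint ℝ c c'‖ ^ 2 ≤ r ^ 2 - ‖c - c'‖ ^ 2 / 4 := by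
    intro x hx
    have h₁ : ‖x - c‖ ^ 2 ≤ r ^ 2 := by
      have := mem_closedBall_iff_norm.mp (hc hx)
      gcongr
    have h₂ : ‖x - c'‖ ^ 2 ≤ r ^ 2 := by
      have := mem_closedBall_iff_norm.mp (hc' hx)
      gcongr
    have hp := parallelogram_law_with_norm ℝ (x - c) (x - c')
    have e₁ : (x - c) + (x - c') = (2 : ℝ) • (x - midpoint ℝ c c') := by
      rw [midpoint_eq_smul_add, smul_sub, smul_smul]
      norm_num
      module
    have e₂ : (x - c) - (x - c') = -(c - c') := by abel
    rw [e₁, e₂, norm_neg, norm_smul] at hp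
    norm_num at hp
    nlinarith
  have hle : r ≤ √(r ^ 2 - ‖c - c'‖ ^ 2 / 4) := by
    refine hmin (midpoint ℝ c c') _ fun x hx => ?_
    rw [mem_closedBall_iff_norm]
    exact Real.le_sqrt_of_sq_le (key x hx)
  have hnonneg := (sq_nonneg _).trans (key s hs)
  have hsq := (Real.le_sqrt hr hnonneg).mp hle
  have h0 : ‖c - c'‖ = 0 := by nlinarith [sq_nonneg ‖c - c'‖]
  exact sub_eq_zero.mp (norm_eq_zero.mp h0)

/-- All isometries preserving a nonempty bounded set have a common fixed point. -/
lemma exists_common_fixedPoint {E : Type*} [NormedAddCommGroup E] [InnerProductSpace ℝ E]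
    [ProperSpace E] {S : Set E} (hS : S.Nonempty) (hb : Bornology.IsBounded S) :
    ∃ c, ∀ f : E → E, Isometry f → f '' S = S → f c = c := by
  obtain ⟨c, r, hc, hmin⟩ := exists_minimal_closedBall hS hb
  refine ⟨c, fun f hf hfS => (center_eq_of_minimal_closedBall hS hc ?_ hmin).symm⟩
  rw [← hfS]
  rintro _ ⟨x, hx, rfl⟩
  simpa [hf.dist_eq] using hc hx

lemma norm_sq_rotAxisDir (β : ℝ) {u : EuclideanSpace ℝ (Fin 3)} (hu : ‖u‖ = 1)
    (x : EuclideanSpace ℝ (Fin 3)) : ‖rotAxisDir β u x‖ ^ 2 = ‖x‖ ^ 2 := by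
  have h₁ : ‖u‖ ^ 2 = 1 := by rw [hu, one_pow]
  have h₂ := Real.sin_sq_add_cos_sq β
  simp only [EuclideanSpace.real_norm_sq_eq, Fin.sum_univ_three] at h₁ ⊢
  simp [rotAxisDir, cross_apply, PiLp.inner_apply, Fin.sum_univ_three]
  linear_combination
    (x 0 ^ 2 + x 1 ^ 2 + x 2 ^ 2 - (u 0 * x 0 + u 1 * x 1 + u 2 * x 2) ^ 2) * h₂
    + (sin β ^ 2 * (x 0 ^ 2 + x 1 ^ 2 + x 2 ^ 2)
      + (1 - cos β) ^ 2 * (u 0 * x 0 + u 1 * x 1 + u 2 * x 2) ^ 2) * h₁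

lemma rotAxisDir_sub (β : ℝ) (u x y : EuclideanSpace ℝ (Fin 3)) :
    rotAxisDir β u (x - y) = rotAxisDir β u x - rotAxisDir β u y := by
  simp only [rotAxisDir, WithLp.equiv_apply, WithLp.equiv_symm_apply, WithLp.ofLp_sub, map_sub,
    WithLp.toLp_sub, inner_sub_right]
  module

lemma isometry_rotLine (β : ℝ) (p : EuclideanSpace ℝ (Fin 3)) {u : EuclideanSpace ℝ (Fin 3)}
    (hu : ‖u‖ = 1) : Isometry (rotLine β p u) := by
  refine Isometry.of_dist_eq fun x y => ?_
  rw [dist_eq_norm, dist_eq_norm, rotLine, rotLine, add_sub_add_left_eq_sub, ← rotAxisDir_sub,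
    sub_sub_sub_cancel_right]
  exact (sq_eq_sq₀ (norm_nonneg _) (norm_nonneg _)).mp (norm_sq_rotAxisDir β hu _)

lemma inner_rotAxisDir_self (β : ℝ) (u x : EuclideanSpace ℝ (Fin 3)) :
    ⟪x, rotAxisDir β u x⟫ = cos β * ‖x‖ ^ 2 + (1 - cos β) * ⟪u, x⟫ ^ 2 := by
  simp [rotAxisDir, cross_apply, PiLp.inner_apply, Fin.sum_univ_three,
    EuclideanSpace.real_norm_sq_eq]
  ring

/-- A nontrivial rotation fixes only the points of its axis. -/
lemma mem_affLine_of_rotLine_eq {β : ℝ} (hβ : cos β ≠ 1) {p u c : EuclideanSpace ℝ (Fin 3)}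
    (hu : ‖u‖ = 1) (hc : rotLine β p u c = c) : c ∈ affLine p u := by
  have hfix : rotAxisDir β u (c - p) = c - p := eq_sub_of_add_eq' hc
  have h := inner_rotAxisDir_self β u (c - p)
  rw [hfix, real_inner_self_eq_norm_sq] at h
  have heq : ‖c - p‖ ^ 2 = ⟪u, c - p⟫ ^ 2 :=
    mul_left_cancel₀ (sub_ne_zero.mpr hβ.symm) (by linear_combination h)
  have hzero : ‖(c - p) - ⟪u, c - p⟫ • u‖ ^ 2 = 0 := by
    rw [norm_sub_sq_real, norm_smul, hu, inner_smul_right, real_inner_comm u (c - p), mul_one,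
      Real.norm_eq_abs, sq_abs, heq]
    ring
  have hsub := sub_eq_zero.mp (norm_eq_zero.mp (pow_eq_zero_iff two_ne_zero |>.mp hzero))
  exact ⟨⟪u, c - p⟫, by rw [← hsub, add_sub_cancel]⟩

lemma cos_two_pi_div_ne_one {a : ℕ} (ha : 2 ≤ a) : cos (2 * π / a) ≠ 1 := by
  have ha' : (2 : ℝ) ≤ a := by exact_mod_cast ha
  have hpos : 0 < 2 * π / a := by positivity
  have hlt : 2 * π / a < 2 * π := div_lt_self (by positivity) (by linarith)
  rw [Ne, Real.cos_eq_one_iff_of_lt_of_lt (by linarith [Real.pi_pos]) hlt]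
  exact hpos.ne'

/-- two axes of rotational symmetry (with angles `2π/a₁`, `2π/a₂`,
`a₁, a₂ ≥ 2`) of a closed embedded curve of positive length must intersect. -/
theorem rotation_axes_intersect
    (Γ : ℝ → EuclideanSpace ℝ (Fin 3)) (K : NNReal) (hΓlip : LipschitzWith K Γ)
    (hΓper : Function.Periodic Γ 1) (hΓinj : Set.InjOn Γ (Set.Ico 0 1))
    (hlen : 0 < ∫ τ in (0:ℝ)..1, ‖deriv Γ τ‖)
    (a₁ a₂ : ℕ) (ha₁ : 2 ≤ a₁) (ha₂ : 2 ≤ a₂)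
    (p₁ u₁ p₂ u₂ : EuclideanSpace ℝ (Fin 3)) (hu₁ : ‖u₁‖ = 1) (hu₂ : ‖u₂‖ = 1)
    (hsym₁ : rotLine (2 * Real.pi / a₁) p₁ u₁ '' Set.range Γ = Set.range Γ)
    (hsym₂ : rotLine (2 * Real.pi / a₂) p₂ u₂ '' Set.range Γ = Set.range Γ) :
    (affLine p₁ u₁ ∩ affLine p₂ u₂).Nonempty := by
  have hbdd : Bornology.IsBounded (Set.range Γ) := by
    rw [← hΓper.image_Icc one_pos 0]
    exact (isCompact_Icc.image hΓlip.continuous).isBounded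
  obtain ⟨c, hc⟩ := exists_common_fixedPoint (Set.range_nonempty Γ) hbdd
  exact ⟨c,
    mem_affLine_of_rotLine_eq (cos_two_pi_div_ne_one ha₁) hu₁
      (hc _ (isometry_rotLine _ p₁ hu₁) hsym₁),
    mem_affLine_of_rotLine_eq (cos_two_pi_div_ne_one ha₂) hu₂
      (hc _ (isometry_rotLine _ p₂ hu₂) hsym₂)⟩
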